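/- Let X = X(G, C) be a normal Cayley graph on at least five vertices. Then any set of pairwise strongly cospectral vertices in X has size at most |G|/3. -/

import Mathlib

open Matrix

/-- `E` is the orthogonal projection onto the eigenspace of `A` for the eigenvalue `μ`. -/
def IsEigenProjection {V : Type*} [Fintype V] (A : Matrix V V ℝ) (μ : ℝ)
    (E : Matrix V V ℝ) : Prop :=
  E * E = E ∧ E.IsSymm ∧
    (∀ x : V → ℝ, A.mulVec (E.mulVec x) = μ • E.mulVec x) ∧
    (∀ y : V → ℝ, A.mulVec y = μ • y → E.mulVec y = y)

/-- Vertices `u` and `v` are strongly cospectral: `E e_u = ± E e_v` for every spectral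
idempotent `E` of `A`. -/
def StronglyCospectral {V : Type*} [Fintype V] [DecidableEq V]
    (A : Matrix V V ℝ) (u v : V) : Prop :=
  ∀ (μ : ℝ) (E : Matrix V V ℝ), IsEigenProjection A μ E →
    E.mulVec (Pi.single u 1) = E.mulVec (Pi.single v 1) ∨
    E.mulVec (Pi.single u 1) = -E.mulVec (Pi.single v 1)

/-- The adjacency matrix of the Cayley graph `X(G, C)`: `g ~ h` iff `h * g⁻¹ ∈ C`. -/
def cayleyAdj {G : Type*} [Group G] [Fintype G] [DecidableEq G] (C : Finset G) :
    Matrix G G ℝ :=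
  Matrix.of fun g h => if h * g⁻¹ ∈ C then 1 else 0

/-- A real symmetric matrix is orthogonally diagonalizable. -/
lemma exists_orthogonal_diagonalization {V : Type*} [Fintype V] [DecidableEq V]
    {A : Matrix V V ℝ} (hA : A.IsSymm) :
    ∃ (U : Matrix V V ℝ) (d : V → ℝ),
      U * Uᵀ = 1 ∧ Uᵀ * U = 1 ∧ A = U * diagonal d * Uᵀ := by
  have hH : A.IsHermitian := by
    rw [Matrix.IsHermitian, conjTranspose_eq_transpose_of_trivial]
    exact hA
  refine ⟨hH.eigenvectorUnitary, hH.eigenvalues, ?_, ?_, ?_⟩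
  · have := Unitary.coe_mul_star_self hH.eigenvectorUnitary
    rwa [Unitary.coe_star, star_eq_conjTranspose, conjTranspose_eq_transpose_of_trivial] at this
  · have := Unitary.coe_star_mul_self hH.eigenvectorUnitary
    rwa [star_eq_conjTranspose, conjTranspose_eq_transpose_of_trivial] at this
  · have := hH.spectral_theorem
    rwa [Unitary.conjStarAlgAut_apply, star_eq_conjTranspose,
      conjTranspose_eq_transpose_of_trivial] at this

lemma exists_isEigenProjection {V : Type*} [Fintype V] [DecidableEq V]
    {A : Matrix V V ℝ} (hA : A.IsSymm) (μ : ℝ) : ∃ E, IsEigenProjection A μ E := by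
  obtain ⟨U, d, hUU, hUU', rfl⟩ := exists_orthogonal_diagonalization hA
  set p : V → ℝ := fun i => if d i = μ then 1 else 0 with hp
  have hcancel : ∀ M N : Matrix V V ℝ, U * M * Uᵀ * (U * N * Uᵀ) = U * (M * N) * Uᵀ := by
    intro M N
    calc U * M * Uᵀ * (U * N * Uᵀ) = U * M * (Uᵀ * U) * N * Uᵀ := by
          simp only [Matrix.mul_assoc]
      _ = U * (M * N) * Uᵀ := by rw [hUU', Matrix.mul_one, Matrix.mul_assoc U]
  refine ⟨U * diagonal p * Uᵀ, ?_, ?_, ?_, ?_⟩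
  · rw [hcancel, diagonal_mul_diagonal]
    congr 3
    ext i
    simp [hp]
  · simp [Matrix.IsSymm, Matrix.transpose_mul, Matrix.mul_assoc]
  · intro x
    have hdp : diagonal d * diagonal p = μ • diagonal p := by
      rw [diagonal_mul_diagonal, ← diagonal_smul]
      congr 1
      ext i
      by_cases h : d i = μ <;> simp [hp, h]
    rw [Matrix.mulVec_mulVec, hcancel, hdp, ← Matrix.smul_mulVec]
    simp
  · intro y hy
    have hy' : diagonal d *ᵥ (Uᵀ *ᵥ y) = μ • (Uᵀ *ᵥ y) := by
      have := congrArg (fun v => Uᵀ *ᵥ v) hy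
      simp only [Matrix.mulVec_mulVec, Matrix.mulVec_smul] at this
      rwa [← Matrix.mul_assoc, ← Matrix.mul_assoc, hUU', Matrix.one_mul,
        ← Matrix.mulVec_mulVec] at this
    have hp' : diagonal p *ᵥ (Uᵀ *ᵥ y) = Uᵀ *ᵥ y := by
      ext i
      have hi := congrFun hy' i
      simp only [mulVec_diagonal, Pi.smul_apply, smul_eq_mul] at hi ⊢
      by_cases h : d i = μ
      · simp [hp, h]
      · have : (d i - μ) * (Uᵀ *ᵥ y) i = 0 := by linarith
        rcases mul_eq_zero.mp this with h' | h'
        · exact absurd (sub_eq_zero.mp h') h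
        · simp [h']
    rw [← Matrix.mulVec_mulVec, ← Matrix.mulVec_mulVec, hp', Matrix.mulVec_mulVec, hUU,
      Matrix.one_mulVec]

/-- The eigenvectors of a real symmetric matrix separate the indices. -/
lemma eq_of_forall_eigenvector_apply_eq {V : Type*} [Fintype V] [DecidableEq V]
    {A : Matrix V V ℝ} (hA : A.IsSymm) {x y : V}
    (h : ∀ (μ : ℝ) (f : V → ℝ), A *ᵥ f = μ • f → f x = f y) : x = y := by
  obtain ⟨U, d, hUU, hUU', rfl⟩ := exists_orthogonal_diagonalization hA
  have hcol : ∀ i, U x i = U y i := by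
    intro i
    refine h (d i) (fun j => U j i) ?_
    have hi : (fun j => U j i) = U *ᵥ Pi.single i 1 := by
      ext j
      simp
    rw [hi, Matrix.mulVec_mulVec, Matrix.mul_assoc _ _ U, hUU', Matrix.mul_one,
      ← Matrix.mulVec_mulVec, diagonal_mulVec_single, ← Matrix.mulVec_smul]
    congr 1
    ext j
    simp [Pi.single_apply]
  by_contra hxy
  have hx := congrFun (congrFun hUU x) x
  have hy := congrFun (congrFun hUU x) y
  rw [Matrix.mul_apply] at hx hy
  simp only [Matrix.transpose_apply, ← hcol, Matrix.one_apply_eq, Matrix.one_apply_ne hxy]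
    at hx hy
  linarith

/-- Entries of eigenvectors at strongly cospectral vertices agree up to a sign depending only
on the eigenvalue. -/
lemma StronglyCospectral.eigenvector_apply {V : Type*} [Fintype V] [DecidableEq V]
    {A : Matrix V V ℝ} (hA : A.IsSymm) {u v : V} (huv : StronglyCospectral A u v) (μ : ℝ) :
    (∀ f : V → ℝ, A *ᵥ f = μ • f → f u = f v) ∨
      (∀ f : V → ℝ, A *ᵥ f = μ • f → f u = -f v) := by
  obtain ⟨E, hE⟩ := exists_isEigenProjection hA μ
  have key : ∀ f : V → ℝ, A *ᵥ f = μ • f → ∀ w, f w = f ⬝ᵥ (E *ᵥ Pi.single w 1) := by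
    intro f hf w
    rw [Matrix.dotProduct_mulVec, ← Matrix.mulVec_transpose, hE.2.1, hE.2.2.2 f hf]
    simp
  refine (huv μ E hE).imp (fun h f hf => ?_) fun h f hf => ?_
  · rw [key f hf u, key f hf v, h]
  · rw [key f hf u, key f hf v, h, dotProduct_neg]

section Cayley

variable {G : Type*} [Group G] [Fintype G] [DecidableEq G]

lemma cayleyAdj_mulVec (C : Finset G) (f : G → ℝ) (g : G) :
    (cayleyAdj C *ᵥ f) g = ∑ c ∈ C, f (c * g) := by
  simp only [Matrix.mulVec, dotProduct, cayleyAdj, Matrix.of_apply, ite_mul, one_mul, zero_mul]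
  rw [← Equiv.sum_comp (Equiv.mulRight g)]
  simp

lemma cayleyAdj_mulVec_eq_smul_iff (C : Finset G) (f : G → ℝ) (μ : ℝ) :
    cayleyAdj C *ᵥ f = μ • f ↔ ∀ g, ∑ c ∈ C, f (c * g) = μ * f g := by
  simp [funext_iff, cayleyAdj_mulVec]

lemma cayleyAdj_isSymm {C : Finset G} (hinv : ∀ c ∈ C, c⁻¹ ∈ C) : (cayleyAdj C).IsSymm := by
  ext g h
  have : g * h⁻¹ ∈ C ↔ h * g⁻¹ ∈ C :=
    ⟨fun H => by simpa using hinv _ H, fun H => by simpa using hinv _ H⟩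
  simp [cayleyAdj, this]

lemma eigenvector_mul_right {C : Finset G} {f : G → ℝ} {μ : ℝ}
    (hf : cayleyAdj C *ᵥ f = μ • f) (x : G) :
    cayleyAdj C *ᵥ (fun g => f (g * x)) = μ • fun g => f (g * x) := by
  rw [cayleyAdj_mulVec_eq_smul_iff] at hf ⊢
  intro g
  simpa [mul_assoc] using hf (g * x)

lemma eigenvector_conj {C : Finset G} (hnorm : ∀ x : G, ∀ c ∈ C, x⁻¹ * c * x ∈ C)
    {f : G → ℝ} {μ : ℝ} (hf : cayleyAdj C *ᵥ f = μ • f) (x : G) :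
    cayleyAdj C *ᵥ (fun g => f (x * g * x⁻¹)) = μ • fun g => f (x * g * x⁻¹) := by
  rw [cayleyAdj_mulVec_eq_smul_iff] at hf ⊢
  intro g
  rw [← hf (x * g * x⁻¹)]
  refine Finset.sum_bij' (fun c _ => x * c * x⁻¹) (fun c _ => x⁻¹ * c * x) ?_ ?_ ?_ ?_ ?_
  · intro c hc
    simpa using hnorm x⁻¹ c hc
  · intro c hc
    exact hnorm x c hc
  · intro c _
    group
  · intro c _
    group
  · intro c _
    congr 1
    group

/-- The elements whose left translation acts on every eigenspace of the Cayley graph as `1` or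
as `-1`. -/
def signSubgroup (C : Finset G) : Subgroup G where
  carrier := {z | ∀ μ : ℝ,
    (∀ f : G → ℝ, cayleyAdj C *ᵥ f = μ • f → ∀ g, f (z * g) = f g) ∨
      (∀ f : G → ℝ, cayleyAdj C *ᵥ f = μ • f → ∀ g, f (z * g) = -f g)}
  one_mem' := fun μ => Or.inl fun f _ g => by simp
  mul_mem' := by
    intro a b ha hb μ
    rcases ha μ with ha | ha <;> rcases hb μ with hb | hb
    · exact Or.inl fun f hf g => by rw [mul_assoc, ha f hf, hb f hf]
    · exact Or.inr fun f hf g => by rw [mul_assoc, ha f hf, hb f hf]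
    · exact Or.inr fun f hf g => by rw [mul_assoc, ha f hf, hb f hf]
    · exact Or.inl fun f hf g => by rw [mul_assoc, ha f hf, hb f hf, neg_neg]
  inv_mem' := by
    intro a ha μ
    refine (ha μ).imp (fun ha f hf g => ?_) fun ha f hf g => ?_
    · rw [← ha f hf (a⁻¹ * g), mul_inv_cancel_left]
    · rw [← neg_neg (f (a⁻¹ * g)), ← ha f hf (a⁻¹ * g), mul_inv_cancel_left]

lemma StronglyCospectral.mul_inv_mem_signSubgroup {C : Finset G} (hinv : ∀ c ∈ C, c⁻¹ ∈ C)
    {u v : G} (huv : StronglyCospectral (cayleyAdj C) u v) : u * v⁻¹ ∈ signSubgroup C := by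
  intro μ
  refine (huv.eigenvector_apply (cayleyAdj_isSymm hinv) μ).imp (fun h f hf g => ?_)
    fun h f hf g => ?_
  · simpa [mul_assoc] using h _ (eigenvector_mul_right hf (v⁻¹ * g))
  · simpa [mul_assoc] using h _ (eigenvector_mul_right hf (v⁻¹ * g))

lemma sq_eq_one_of_mem_signSubgroup {C : Finset G} (hinv : ∀ c ∈ C, c⁻¹ ∈ C) {z : G}
    (hz : z ∈ signSubgroup C) : z ^ 2 = 1 := by
  refine eq_of_forall_eigenvector_apply_eq (cayleyAdj_isSymm hinv) fun μ f hf => ?_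
  rw [pow_two, ← mul_one (z * z), mul_assoc]
  rcases hz μ with h | h
  · rw [h f hf, h f hf]
  · rw [h f hf, h f hf, neg_neg]

lemma commute_of_mem_signSubgroup {C : Finset G} (hinv : ∀ c ∈ C, c⁻¹ ∈ C)
    (hnorm : ∀ x : G, ∀ c ∈ C, x⁻¹ * c * x ∈ C) {z : G} (hz : z ∈ signSubgroup C) (x : G) :
    z * x = x * z := by
  rw [eq_comm, ← mul_inv_eq_iff_eq_mul]
  refine eq_of_forall_eigenvector_apply_eq (cayleyAdj_isSymm hinv) fun μ f hf => ?_
  rcases hz μ with h | h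
  all_goals
    have h₁ := h _ (eigenvector_conj hnorm hf x) 1
    have h₂ := h f hf 1
    simp only [mul_one, mul_inv_cancel] at h₁ h₂
    rw [h₁, h₂]

end Cayley

section SignCharacters

variable {G : Type*} [Group G]

open Classical in
/-- The extension by zero of a sign character of a subgroup. -/
noncomputable def extendZero {H : Subgroup G} (ψ : H →* ℤˣ) (g : G) : ℤ :=
  if h : g ∈ H then (ψ ⟨g, h⟩ : ℤ) else 0

lemma extendZero_of_mem {H : Subgroup G} (ψ : H →* ℤˣ) {g : G} (h : g ∈ H) :
    extendZero ψ g = (ψ ⟨g, h⟩ : ℤ) :=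
  dif_pos h

lemma extendZero_of_notMem {H : Subgroup G} (ψ : H →* ℤˣ) {g : G} (h : g ∉ H) :
    extendZero ψ g = 0 :=
  dif_neg h

lemma extendZero_one {H : Subgroup G} (ψ : H →* ℤˣ) : extendZero ψ 1 = 1 := by
  rw [extendZero_of_mem ψ H.one_mem]
  exact congrArg Units.val (map_one ψ)

lemma extendZero_mul {H : Subgroup G} (ψ : H →* ℤˣ) {h : G} (hh : h ∈ H) (g : G) :
    extendZero ψ (h * g) = extendZero ψ h * extendZero ψ g := by
  by_cases hg : g ∈ H
  · rw [extendZero_of_mem ψ hh, extendZero_of_mem ψ hg, extendZero_of_mem ψ (H.mul_mem hh hg),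
      ← Units.val_mul, ← map_mul]
    rfl
  · rw [extendZero_of_notMem ψ hg, extendZero_of_notMem ψ fun H' =>
      hg ((H.mul_mem_cancel_left hh).mp H'), mul_zero]

lemma extendZero_inv {H : Subgroup G} (ψ : H →* ℤˣ) (g : G) :
    extendZero ψ g⁻¹ = extendZero ψ g := by
  by_cases hg : g ∈ H
  · rw [extendZero_of_mem ψ hg, extendZero_of_mem ψ (H.inv_mem hg)]
    have : (⟨g⁻¹, H.inv_mem hg⟩ : H) = ⟨g, hg⟩⁻¹ := rfl
    rw [this, map_inv, Int.units_inv_eq_self]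
  · rw [extendZero_of_notMem ψ hg, extendZero_of_notMem ψ fun H' => hg (by simpa using H')]

lemma extendZero_one_of_mem {H : Subgroup G} {g : G} (hg : g ∈ H) :
    extendZero (1 : H →* ℤˣ) g = 1 := by
  simp [extendZero_of_mem _ hg]

/-- For a subgroup `H` of index two with `t ∉ H`, the function equal to `ψ` on `H` and with
`h * t ↦ ε * ψ h` off `H`. -/
noncomputable def cosetExtension {H : Subgroup G} (ψ : H →* ℤˣ) (t : G) (ε : ℤˣ) (g : G) : ℤ :=
  extendZero ψ g + ε * extendZero ψ (g * t⁻¹)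

lemma mul_inv_mem_iff_of_index_two {H : Subgroup G} (hH : H.index = 2) {t : G} (ht : t ∉ H)
    (g : G) : g * t⁻¹ ∈ H ↔ g ∉ H := by
  rw [Subgroup.mul_mem_iff_of_index_two hH, inv_mem_iff]
  tauto

lemma cosetExtension_mul {H : Subgroup G} (ψ : H →* ℤˣ) (t : G) (ε : ℤˣ) {h : G}
    (hh : h ∈ H) (g : G) :
    cosetExtension ψ t ε (h * g) = extendZero ψ h * cosetExtension ψ t ε g := by
  rw [cosetExtension, cosetExtension, mul_assoc, extendZero_mul ψ hh, extendZero_mul ψ hh]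
  ring

lemma cosetExtension_one {H : Subgroup G} (ψ : H →* ℤˣ) {t : G} (ht : t ∉ H) (ε : ℤˣ) :
    cosetExtension ψ t ε 1 = 1 := by
  rw [cosetExtension, extendZero_one, extendZero_of_notMem ψ (by simpa using ht)]
  simp

lemma odd_cosetExtension {H : Subgroup G} (hH : H.index = 2) (ψ : H →* ℤˣ) {t : G}
    (ht : t ∉ H) (ε : ℤˣ) (g : G) : Odd (cosetExtension ψ t ε g) := by
  have hu : ∀ u : ℤˣ, Odd (u : ℤ) := fun u => by
    rcases Int.units_eq_one_or u with rfl | rfl <;> decide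
  by_cases hg : g ∈ H
  · rw [cosetExtension, extendZero_of_mem ψ hg, extendZero_of_notMem ψ fun h =>
      (mul_inv_mem_iff_of_index_two hH ht g).mp h hg]
    simpa using hu _
  · rw [cosetExtension, extendZero_of_notMem ψ hg,
      extendZero_of_mem ψ ((mul_inv_mem_iff_of_index_two hH ht g).mpr hg), zero_add]
    exact (hu _).mul (hu _)

lemma cosetExtension_one_one {H : Subgroup G} (hH : H.index = 2) {t : G} (ht : t ∉ H) (g : G) :
    cosetExtension (1 : H →* ℤˣ) t 1 g = 1 := by
  by_cases hg : g ∈ H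
  · rw [cosetExtension, extendZero_one_of_mem hg, extendZero_of_notMem _ fun h =>
      (mul_inv_mem_iff_of_index_two hH ht g).mp h hg]
    simp
  · rw [cosetExtension, extendZero_of_notMem _ hg,
      extendZero_one_of_mem ((mul_inv_mem_iff_of_index_two hH ht g).mpr hg)]
    simp

/-- The sum of a coset extension over a connection set is an eigenvalue. -/
lemma sum_cosetExtension_mul {H : Subgroup G} (hH : H.index = 2)
    (hcen : ∀ h ∈ H, ∀ x : G, h * x = x * h) {C : Finset G} (hinv : ∀ c ∈ C, c⁻¹ ∈ C)
    (ψ : H →* ℤˣ) {t : G} (ht : t ∉ H) (ε : ℤˣ) (g : G) :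
    ∑ c ∈ C, cosetExtension ψ t ε (c * g) =
      (∑ c ∈ C, cosetExtension ψ t ε c) * cosetExtension ψ t ε g := by
  have hε : (ε : ℤ) * ε = 1 := by
    rcases Int.units_eq_one_or ε with rfl | rfl <;> rfl
  have htt : ∑ c ∈ C, extendZero ψ (c * t) = ∑ c ∈ C, extendZero ψ (c * t⁻¹) := by
    refine Finset.sum_bij' (fun c _ => c⁻¹) (fun c _ => c⁻¹) hinv hinv ?_ ?_ ?_
    · simp
    · simp
    · intro c _
      rw [← extendZero_inv, _root_.mul_inv_rev]
      by_cases hc : t⁻¹ * c⁻¹ ∈ H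
      · congr 1
        exact eq_mul_inv_of_mul_eq ((hcen _ hc t).trans (mul_inv_cancel_left t c⁻¹))
      · rw [extendZero_of_notMem ψ hc, extendZero_of_notMem ψ]
        rwa [Subgroup.mul_mem_iff_of_index_two hH, iff_comm,
          ← Subgroup.mul_mem_iff_of_index_two hH]
  have hleft : ∀ h ∈ H, ∀ x, ∑ c ∈ C, cosetExtension ψ t ε (c * (h * x)) =
      extendZero ψ h * ∑ c ∈ C, cosetExtension ψ t ε (c * x) := by
    intro h hh x
    rw [Finset.mul_sum]
    refine Finset.sum_congr rfl fun c _ => ?_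
    rw [← mul_assoc, ← hcen h hh, mul_assoc, cosetExtension_mul ψ t ε hh]
  by_cases hg : g ∈ H
  · have := hleft g hg 1
    have h' := cosetExtension_mul ψ t ε hg 1
    rw [mul_one, cosetExtension_one ψ ht, mul_one] at h'
    simp only [mul_one] at this
    rw [this, h', mul_comm]
  · have hm := (mul_inv_mem_iff_of_index_two hH ht g).mpr hg
    have := hleft _ hm t
    have h' := cosetExtension_mul ψ t ε hm t
    rw [inv_mul_cancel_right] at this h'
    rw [this, h']
    have ht₁ : cosetExtension ψ t ε t = ε := by
      rw [cosetExtension, extendZero_of_notMem ψ ht, mul_inv_cancel, extendZero_one]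
      simp
    have hsum : ∑ c ∈ C, cosetExtension ψ t ε (c * t) =
        ε * ∑ c ∈ C, cosetExtension ψ t ε c := by
      simp only [cosetExtension, Finset.sum_add_distrib, ← Finset.mul_sum, mul_inv_cancel_right,
        htt, mul_add, ← mul_assoc, hε, one_mul]
      ring
    rw [ht₁, hsum]
    ring

lemma hasEnoughRootsOfUnity_int_two : HasEnoughRootsOfUnity ℤ 2 where
  prim := ⟨-1, IsPrimitiveRoot.neg_one 0 (by decide)⟩
  cyc := rootsOfUnity.isCyclic ℤ 2

/-- A finite commutative group of exponent two has as many sign characters as elements, and they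
separate points. -/
lemma card_signCharacters {A : Type*} [CommGroup A] [Finite A] (hA : ∀ a : A, a ^ 2 = 1) :
    Nat.card (A →* ℤˣ) = Nat.card A ∧ ∀ a : A, a ≠ 1 → ∃ φ : A →* ℤˣ, φ a ≠ 1 := by
  have := hasEnoughRootsOfUnity_int_two
  have : HasEnoughRootsOfUnity ℤ (Monoid.exponent A) :=
    HasEnoughRootsOfUnity.of_dvd ℤ (Monoid.exponent_dvd_of_forall_pow_eq_one hA)
  exact ⟨CommGroup.card_monoidHom_of_hasEnoughRootsOfUnity A ℤ,
    fun a ha => CommGroup.exists_apply_ne_one_of_hasEnoughRootsOfUnity A ℤ ha⟩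

lemma sum_signCharacters_apply {A : Type*} [CommGroup A] [Fintype (A →* ℤˣ)] {a : A}
    (ha : ∃ φ : A →* ℤˣ, φ a ≠ 1) : ∑ ψ : A →* ℤˣ, (ψ a : ℤ) = 0 := by
  obtain ⟨φ, hφ⟩ := ha
  have h := Equiv.sum_comp (Equiv.mulLeft φ) fun ψ : A →* ℤˣ => (ψ a : ℤ)
  simp only [Equiv.coe_mulLeft, MonoidHom.mul_apply, Units.val_mul, ← Finset.mul_sum,
    (Int.units_eq_one_or (φ a)).resolve_left hφ] at h
  simp only [Units.val_neg, Units.val_one] at h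
  linarith

open Classical in
lemma sum_extendZero_mul_extendZero {H : Subgroup G} [Fintype (H →* ℤˣ)]
    (hcomm : ∀ a b : H, a * b = b * a) (hsep : ∀ a : H, a ≠ 1 → ∃ φ : H →* ℤˣ, φ a ≠ 1)
    (x y : G) :
    ∑ ψ : H →* ℤˣ, extendZero ψ x * extendZero ψ y =
      if x = y ∧ x ∈ H then (Fintype.card (H →* ℤˣ) : ℤ) else 0 := by
  by_cases hx : x ∈ H
  · by_cases hy : y ∈ H
    · let _ : CommGroup H := { (inferInstance : Group H) with mul_comm := hcomm }
      have hxy : ∀ ψ : H →* ℤˣ, extendZero ψ x * extendZero ψ y =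
          (ψ (⟨x, hx⟩ * ⟨y, hy⟩⁻¹) : ℤ) := by
        intro ψ
        rw [extendZero_of_mem ψ hx, extendZero_of_mem ψ hy, map_mul, map_inv,
          Int.units_inv_eq_self, Units.val_mul]
      simp only [hxy]
      by_cases h : x = y
      · subst h
        simp [hx]
      · rw [if_neg fun h' => h h'.1]
        refine sum_signCharacters_apply (hsep _ fun h' => h ?_)
        exact congrArg Subtype.val (mul_inv_eq_one.mp h')
    · rw [if_neg (by rintro ⟨rfl, h⟩; exact hy h)]
      exact Finset.sum_eq_zero fun ψ _ => by rw [extendZero_of_notMem ψ hy, mul_zero]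
  · rw [if_neg fun h => hx h.2]
    exact Finset.sum_eq_zero fun ψ _ => by rw [extendZero_of_notMem ψ hx, zero_mul]

/-- Parseval's identity for the coset extensions. -/
lemma sum_sq_sum_cosetExtension {H : Subgroup G} [Fintype (H →* ℤˣ)] (hH : H.index = 2)
    (hcomm : ∀ a b : H, a * b = b * a) (hsep : ∀ a : H, a ≠ 1 → ∃ φ : H →* ℤˣ, φ a ≠ 1)
    {t : G} (ht : t ∉ H) (C : Finset G) :
    ∑ ψ : H →* ℤˣ, (∑ c ∈ C, cosetExtension ψ t 1 c) ^ 2 +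
      ∑ ψ : H →* ℤˣ, (∑ c ∈ C, cosetExtension ψ t (-1) c) ^ 2 =
        2 * Fintype.card (H →* ℤˣ) * C.card := by
  classical
  have hpair : ∀ ψ : H →* ℤˣ, (∑ c ∈ C, cosetExtension ψ t 1 c) ^ 2 +
      (∑ c ∈ C, cosetExtension ψ t (-1) c) ^ 2 =
      2 * ∑ c ∈ C, ∑ d ∈ C, (extendZero ψ c * extendZero ψ d +
        extendZero ψ (c * t⁻¹) * extendZero ψ (d * t⁻¹)) := by
    intro ψ
    simp only [cosetExtension, Finset.sum_add_distrib, ← Finset.mul_sum, ← Finset.sum_mul]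
    push_cast
    ring
  have hdiag : ∀ c d : G, ∑ ψ : H →* ℤˣ, (extendZero ψ c * extendZero ψ d +
      extendZero ψ (c * t⁻¹) * extendZero ψ (d * t⁻¹)) =
      if c = d then (Fintype.card (H →* ℤˣ) : ℤ) else 0 := by
    intro c d
    rw [Finset.sum_add_distrib, sum_extendZero_mul_extendZero hcomm hsep,
      sum_extendZero_mul_extendZero hcomm hsep]
    by_cases h : c = d
    · by_cases hc : c ∈ H <;> simp [h, mul_inv_mem_iff_of_index_two hH ht, h ▸ hc]
    · simp [h]
  rw [← Finset.sum_add_distrib, Finset.sum_congr rfl fun ψ _ => hpair ψ, ← Finset.mul_sum,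
    Finset.sum_comm]
  simp_rw [Finset.sum_comm (s := Finset.univ) (t := C), hdiag]
  simp
  ring

end SignCharacters

/-- Among `m` distinct integers of the same parity, one has absolute value at least `m - 1`. -/
lemma exists_card_sub_one_le_abs {T : Finset ℤ} (hne : T.Nonempty) {k : ℤ}
    (hT : ∀ x ∈ T, Even (x - k)) : ∃ x ∈ T, (T.card : ℤ) - 1 ≤ |x| := by
  by_contra! hlt
  have hcard := Finset.card_le_card_of_injOn (s := T)
    (t := Finset.Icc (0 : ℤ) (T.card - 2)) (fun x => (x + T.card - 2) / 2) ?_ ?_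
  · have : 0 < T.card := hne.card_pos
    rw [Int.card_Icc] at hcard
    omega
  · intro x hx
    have := hlt x hx
    rw [abs_lt] at this
    simp only [Finset.coe_Icc, Set.mem_Icc]
    omega
  · intro x hx y hy hxy
    obtain ⟨a, ha⟩ := hT x hx
    obtain ⟨b, hb⟩ := hT y hy
    simp only at hxy
    omega

lemma card_bound_le_sum_sq (T : Finset ℤ) {k : ℤ} (hT : ∀ x ∈ T, Even (x - k)) :
    ((T.card : ℤ) - 1) * T.card * (2 * T.card - 1) ≤ 6 * ∑ x ∈ T, x ^ 2 := by
  induction hn : T.card generalizing T with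
  | zero =>
    rw [Finset.card_eq_zero.mp hn]
    simp
  | succ n ih =>
    obtain ⟨x, hx, hxT⟩ := exists_card_sub_one_le_abs
      (Finset.card_pos.mp (hn ▸ n.succ_pos)) hT
    have hrec := ih (T.erase x) (fun y hy => hT y (Finset.mem_of_mem_erase hy))
      (by rw [Finset.card_erase_of_mem hx, hn, Nat.add_sub_cancel])
    rw [← Finset.add_sum_erase T _ hx]
    have hsq : (n : ℤ) ^ 2 ≤ x ^ 2 := by
      rw [← sq_abs x]
      rw [hn] at hxT
      push_cast at hxT
      exact pow_le_pow_left₀ (by positivity) (by linarith) 2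
    push_cast
    nlinarith

/-- The subgroup of sign translations of a normal Cayley graph contains no subgroup of index two
and order at least four. -/
lemma not_le_signSubgroup_of_index_two {G : Type*} [Group G] [Fintype G] [DecidableEq G]
    {C : Finset G} (hinv : ∀ c ∈ C, c⁻¹ ∈ C) (hnorm : ∀ x : G, ∀ c ∈ C, x⁻¹ * c * x ∈ C)
    {H : Subgroup G} (hH : H.index = 2) (hcard : 4 ≤ Nat.card H) : ¬ H ≤ signSubgroup C := by
  intro hle
  classical
  have hcen : ∀ h ∈ H, ∀ x : G, h * x = x * h := fun h hh x =>
    commute_of_mem_signSubgroup hinv hnorm (hle hh) x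
  have hcomm : ∀ a b : H, a * b = b * a := fun a b => Subtype.ext (hcen a a.2 b)
  have hexp : ∀ a : H, a ^ 2 = 1 := fun a =>
    Subtype.ext (sq_eq_one_of_mem_signSubgroup hinv (hle a.2))
  obtain ⟨hchar, hsep⟩ : Nat.card (H →* ℤˣ) = Nat.card H ∧
      ∀ a : H, a ≠ 1 → ∃ φ : H →* ℤˣ, φ a ≠ 1 := by
    let _ : CommGroup H := { (inferInstance : Group H) with mul_comm := hcomm }
    exact card_signCharacters hexp
  have : Finite (H →* ℤˣ) := Nat.finite_of_card_ne_zero (by omega)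
  have := Fintype.ofFinite (H →* ℤˣ)
  rw [← hchar, Nat.card_eq_fintype_card] at hcard
  obtain ⟨t, ht⟩ : ∃ t, t ∉ H := by
    by_contra! hall
    rw [(Subgroup.eq_top_iff' H).mpr hall] at hH
    simp at hH
  set lam : ℤˣ → (H →* ℤˣ) → ℤ := fun ε ψ => ∑ c ∈ C, cosetExtension ψ t ε c with hlam
  have heig : ∀ ε ψ, cayleyAdj C *ᵥ (fun g => (cosetExtension ψ t ε g : ℝ)) =
      (lam ε ψ : ℝ) • fun g => (cosetExtension ψ t ε g : ℝ) := by
    intro ε ψ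
    rw [cayleyAdj_mulVec_eq_smul_iff]
    intro g
    exact_mod_cast sum_cosetExtension_mul hH hcen hinv ψ ht ε g
  have hval : ∀ ε (ψ : H →* ℤˣ) (h : H), cosetExtension ψ t ε (h * 1) = (ψ h : ℤ) := by
    intro ε ψ h
    rw [cosetExtension_mul ψ t ε h.2, cosetExtension_one ψ ht, mul_one,
      extendZero_of_mem ψ h.2]
  have hinj : ∀ ε, Function.Injective (lam ε) := by
    intro ε ψ φ hψφ
    ext h
    have h₁ := heig ε ψ
    have h₂ := heig ε φ
    rw [← hψφ] at h₂
    rw [← hval ε ψ h, ← hval ε φ h]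
    rcases hle h.2 (lam ε ψ) with hs | hs
    all_goals
      have e₁ := hs _ h₁ 1
      have e₂ := hs _ h₂ 1
      simp only [cosetExtension_one _ ht] at e₁ e₂
      exact_mod_cast e₁.trans e₂.symm
  have hpar : ∀ ε ψ, Even (lam ε ψ - C.card) := by
    intro ε ψ
    have : lam ε ψ - C.card = ∑ c ∈ C, (cosetExtension ψ t ε c - 1) := by
      simp [hlam]
    rw [this]
    exact Finset.even_sum _ fun c _ => (odd_cosetExtension hH ψ ht ε c).sub_odd odd_one
  have hone : lam 1 1 = C.card := by
    simp [hlam, cosetExtension_one_one hH ht]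
  have hpos := card_bound_le_sum_sq ((Finset.univ.erase (1 : H →* ℤˣ)).image (lam 1))
    (k := C.card) (by
      simp only [Finset.mem_image]
      rintro x ⟨ψ, -, rfl⟩
      exact hpar 1 ψ)
  have hneg := card_bound_le_sum_sq (Finset.univ.image (lam (-1))) (k := C.card) (by
      simp only [Finset.mem_image]
      rintro x ⟨ψ, -, rfl⟩
      exact hpar (-1) ψ)
  rw [Finset.card_image_of_injective _ (hinj _), Finset.sum_image (hinj _).injOn] at hpos hneg
  rw [Finset.card_erase_of_mem (Finset.mem_univ _), Finset.card_univ,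
    Nat.cast_sub (by omega)] at hpos
  rw [Finset.card_univ] at hneg
  have hparseval := sum_sq_sum_cosetExtension hH hcomm hsep ht C
  have hsplit := Finset.add_sum_erase Finset.univ (fun ψ => lam 1 ψ ^ 2)
    (Finset.mem_univ (1 : H →* ℤˣ))
  simp only [hone] at hsplit
  change ∑ ψ, lam 1 ψ ^ 2 + ∑ ψ, lam (-1) ψ ^ 2 = _ at hparseval
  rw [← hsplit] at hparseval
  have hm : (4 : ℤ) ≤ Fintype.card (H →* ℤˣ) := by exact_mod_cast hcard
  generalize (Fintype.card (H →* ℤˣ) : ℤ) = m at *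
  generalize (C.card : ℤ) = k at *
  push_cast at hpos
  obtain ⟨a, rfl⟩ : ∃ a, m = a + 4 := ⟨m - 4, by ring⟩
  have ha : 0 ≤ a := by linarith
  nlinarith [sq_nonneg (k - (a + 4)), pow_nonneg ha 2, pow_nonneg ha 3]

theorem stmt17 {G : Type*} [Group G] [Fintype G] [DecidableEq G]
    (h5 : 5 ≤ Fintype.card G) (C : Finset G)
    (h1 : (1 : G) ∉ C) (hinv : ∀ c ∈ C, c⁻¹ ∈ C)
    (hnorm : ∀ x : G, ∀ c ∈ C, x⁻¹ * c * x ∈ C)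
    (S : Finset G) (hS : ∀ u ∈ S, ∀ v ∈ S, StronglyCospectral (cayleyAdj C) u v) :
    3 * S.card ≤ Fintype.card G := by
  by_contra! hlt
  obtain ⟨v, hv⟩ : S.Nonempty := Finset.card_pos.mp (by omega)
  set K := signSubgroup C
  have hSK : S.card ≤ Nat.card K := by
    rw [← Fintype.card_coe, ← Nat.card_eq_fintype_card]
    refine Nat.card_le_card_of_injective
      (fun u : S => (⟨u * v⁻¹, (hS u u.2 v hv).mul_inv_mem_signSubgroup hinv⟩ : K)) ?_
    intro a b hab
    exact Subtype.ext (mul_right_cancel (congrArg Subtype.val hab))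
  have hmul := K.card_mul_index
  rw [Nat.card_eq_fintype_card (α := G)] at hmul
  have hindex : K.index = 1 ∨ K.index = 2 := by
    have h0 : K.index ≠ 0 := Subgroup.index_ne_zero_of_finite
    have h3 : K.index < 3 := by
      by_contra! h
      have := Nat.mul_le_mul_left (Nat.card K) h
      omega
    omega
  have hKp : IsPGroup 2 K := fun z =>
    ⟨1, Subtype.ext (by simpa using sq_eq_one_of_mem_signSubgroup hinv z.2)⟩
  have : Fact (Nat.Prime 2) := ⟨Nat.prime_two⟩
  obtain ⟨r, hr⟩ := IsPGroup.iff_card.mp hKp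
  obtain ⟨n, hn⟩ : ∃ n, Fintype.card G = 2 ^ n := by
    rcases hindex with h | h
    · exact ⟨r, by rw [← hmul, h, hr, mul_one]⟩
    · exact ⟨r + 1, by rw [← hmul, h, hr, pow_succ]⟩
  obtain ⟨l, rfl⟩ : ∃ l, n = l + 3 := by
    have : 2 < n := by
      by_contra! h
      have := Nat.pow_le_pow_right two_pos h
      omega
    exact ⟨n - 3, by omega⟩
  have hG : IsPGroup 2 G := IsPGroup.of_card (by rw [Nat.card_eq_fintype_card, hn])
  obtain ⟨H, hHK, hH⟩ := Sylow.exists_subgroup_le_card_pow_prime_of_le_card (n := l + 2)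
    Nat.prime_two hG (H := K) (by
      rcases hindex with h | h <;> rw [h] at hmul <;> rw [pow_succ] at hn <;> omega)
  refine not_le_signSubgroup_of_index_two hinv hnorm (H := H) ?_ ?_ hHK
  · have h := H.card_mul_index
    rw [hH, Nat.card_eq_fintype_card, hn, pow_succ 2 (l + 2)] at h
    exact Nat.eq_of_mul_eq_mul_left (by positivity) h
  · rw [hH, pow_add]
    have := Nat.one_le_two_pow (n := l)
    omega
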